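/- Let p be a prime, k ≥ 1, and n = p^k > 3 odd. Let V = {z ∈ ℂⁿ : z₁ + ⋯ + z_n = 0} with S_n acting by permuting coordinates, and let V⁻ be the same space with the twisted action σ ·⁻ z = sgn(σ)·(σ z). Then α(V) = p and α(V⁻) = 2p. -/

import Mathlib

namespace AlphaChar

variable {G : Type*} [Group G] {V : Type*} [AddCommMonoid V] [Module ℂ V]

/-- The cardinality of the orbit of a vector `v` under the linear action of `G` via `ρ`. -/
noncomputable def orbitCard (ρ : Representation ℂ G V) (v : V) : ℕ :=
  Nat.card (Set.range fun g : G => ρ g v)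

open Classical in
/-- The α-characteristic of a representation: the gcd of the cardinalities of the orbits
of all nonzero vectors. -/
noncomputable def alphaChar [Finite G] (ρ : Representation ℂ G V) : ℕ :=
  ((Finset.range (Nat.card G + 1)).filter
    (fun n => ∃ v : V, v ≠ 0 ∧ orbitCard ρ v = n)).gcd id

/-- A representation is nontrivial if some group element acts as a non-identity operator. -/
def IsNontrivial (ρ : Representation ℂ G V) : Prop := ∃ g : G, ρ g ≠ 1

/-- A representation is irreducible if the space is nonzero and the only invariant
subspaces are `⊥` and `⊤`. -/
def IsIrreducible (ρ : Representation ℂ G V) : Prop :=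
  Nontrivial V ∧
    ∀ U : Submodule ℂ V, (∀ (g : G) (v : V), v ∈ U → ρ g v ∈ U) → U = ⊥ ∨ U = ⊤

end AlphaChar

namespace AlphaChar

/-- The hyperplane {z ∈ ℂⁿ : ∑ zᵢ = 0}. -/
noncomputable def stdSubspace (n : ℕ) : Submodule ℂ (Fin n → ℂ) where
  carrier := {z | ∑ i, z i = 0}
  zero_mem' := by simp
  add_mem' := by
    intro a b ha hb
    simp only [Set.mem_setOf_eq, Pi.add_apply] at *
    rw [Finset.sum_add_distrib, ha, hb, add_zero]
  smul_mem' := by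
    intro c z hz
    simp only [Set.mem_setOf_eq, Pi.smul_apply, smul_eq_mul] at *
    rw [← Finset.mul_sum, hz, mul_zero]

/-- The standard representation of Sₙ on {z ∈ ℂⁿ : ∑ zᵢ = 0}, permuting coordinates. -/
noncomputable def stdRep (n : ℕ) :
    Representation ℂ (Equiv.Perm (Fin n)) ↥(stdSubspace n) where
  toFun σ :=
    { toFun := fun z => ⟨fun i => z.1 (σ⁻¹ i), by
        have hz : ∑ i, z.1 i = 0 := z.2
        show ∑ i, z.1 (σ⁻¹ i) = 0
        rw [Equiv.sum_comp σ⁻¹ z.1]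
        exact hz⟩
      map_add' := by intro a b; ext i; rfl
      map_smul' := by intro c a; ext i; rfl }
  map_one' := by ext z i; simp
  map_mul' := by intro a b; ext z i; simp [mul_assoc]

/-- The standard representation of Sₙ twisted by the sign character. -/
noncomputable def stdRepSign (n : ℕ) :
    Representation ℂ (Equiv.Perm (Fin n)) ↥(stdSubspace n) where
  toFun σ := ((Equiv.Perm.sign σ : ℤ) : ℂ) • stdRep n σ
  map_one' := by
    show ((Equiv.Perm.sign (1 : Equiv.Perm (Fin n)) : ℤ) : ℂ) • stdRep n 1 = 1
    rw [map_one (Equiv.Perm.sign), map_one (stdRep n), Units.val_one, Int.cast_one,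
      one_smul]
  map_mul' := by
    intro a b
    show ((Equiv.Perm.sign (a * b) : ℤ) : ℂ) • (stdRep n) (a * b) =
      (((Equiv.Perm.sign a : ℤ) : ℂ) • stdRep n a) * (((Equiv.Perm.sign b : ℤ) : ℂ) • stdRep n b)
    rw [smul_mul_smul_comm, ← map_mul (stdRep n)]
    congr 1
    rw [← Int.cast_mul, ← Units.val_mul, ← map_mul]

end AlphaChar

namespace AlphaChar

section General

variable {G : Type*} [Group G] {V : Type*} [AddCommMonoid V] [Module ℂ V]

lemma alphaChar_dvd_orbitCard [Finite G] (ρ : Representation ℂ G V) {v : V} (hv : v ≠ 0) :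
    alphaChar ρ ∣ orbitCard ρ v := by
  classical
  refine Finset.gcd_dvd (f := id) (Finset.mem_filter.2 ⟨Finset.mem_range.2 ?_, v, hv, rfl⟩)
  exact Nat.lt_succ_of_le (Finite.card_range_le _)

lemma dvd_alphaChar [Finite G] (ρ : Representation ℂ G V) {d : ℕ}
    (h : ∀ v : V, v ≠ 0 → d ∣ orbitCard ρ v) : d ∣ alphaChar ρ := by
  classical
  refine Finset.dvd_gcd fun m hm => ?_
  obtain ⟨-, v, hv, rfl⟩ := Finset.mem_filter.1 hm
  exact h v hv

/-- A self-map of prime power order without fixed points on an orbit forces the prime to divide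
the cardinality of the orbit. -/
lemma prime_dvd_orbitCard [Finite G] (ρ : Representation ℂ G V) (v : V) {p m : ℕ}
    (hp : p.Prime) (f : V → V) (hmaps : ∀ g, f (ρ g v) ∈ Set.range fun g : G => ρ g v)
    (hiter : ∀ g, f^[p ^ m] (ρ g v) = ρ g v) (hfix : ∀ g, f (ρ g v) ≠ ρ g v) :
    p ∣ orbitCard ρ v := by
  classical
  have := Fact.mk hp
  have hm : Set.MapsTo f (Set.range fun g : G => ρ g v) (Set.range fun g : G => ρ g v) := by
    rintro _ ⟨g, rfl⟩
    exact hmaps g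
  let _ : Fintype (Set.range fun g : G => ρ g v) := Fintype.ofFinite _
  let F : Function.End (Set.range fun g : G => ρ g v) := hm.restrict f _ _
  have hF : F ^ p ^ m = 1 := by
    have h1 : F ^ p ^ m = (hm.restrict f _ _)^[p ^ m] := by
      exact (smul_iterate (α := Set.range fun g : G => ρ g v) F (p ^ m)).symm
    rw [h1, hm.iterate_restrict]
    funext ⟨_, g, rfl⟩
    exact Subtype.ext (hiter g)
  have hcard := Equiv.Perm.card_fixedPoints_modEq hF
  have : IsEmpty (Function.fixedPoints F) := by
    refine ⟨?_⟩
    rintro ⟨⟨_, g, rfl⟩, hw⟩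
    exact hfix g (congrArg Subtype.val hw)
  rw [orbitCard, Nat.card_eq_fintype_card, ← Nat.modEq_zero_iff_dvd]
  exact hcard.trans (congrArg (· % p) (Fintype.card_eq_zero_iff.2 this))

/-- If `g` has prime power order and fixes no vector in the orbit of `v`, then the prime divides
the cardinality of the orbit. -/
lemma prime_dvd_orbitCard_of_pow_eq_one [Finite G] (ρ : Representation ℂ G V) (v : V) {p m : ℕ}
    (hp : p.Prime) (g : G) (hg : g ^ p ^ m = 1) (hfix : ∀ h, ρ g (ρ h v) ≠ ρ h v) :
    p ∣ orbitCard ρ v := by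
  refine prime_dvd_orbitCard ρ v (m := m) hp (ρ g)
    (fun h => ⟨g * h, by simp⟩) (fun h => ?_) hfix
  rw [← Module.End.pow_apply, ← map_pow, hg, map_one, Module.End.one_apply]

lemma apply_ne_zero (ρ : Representation ℂ G V) (g : G) {v : V} (hv : v ≠ 0) : ρ g v ≠ 0 := by
  intro h
  apply hv
  have := congrArg (ρ g⁻¹) h
  simpa using this

end General

variable {n : ℕ}

lemma stdRep_apply (σ : Equiv.Perm (Fin n)) (z : stdSubspace n) (i : Fin n) :
    (stdRep n σ z).1 i = z.1 (σ⁻¹ i) := rfl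

lemma stdRepSign_apply (σ : Equiv.Perm (Fin n)) (z : stdSubspace n) :
    stdRepSign n σ z = ((Equiv.Perm.sign σ : ℤ) : ℂ) • stdRep n σ z := rfl

lemma stdRepSign_of_sign_eq_one {σ : Equiv.Perm (Fin n)} (h : Equiv.Perm.sign σ = 1)
    (z : stdSubspace n) : stdRepSign n σ z = stdRep n σ z := by
  simp [stdRepSign_apply, h]

lemma stdRepSign_of_sign_eq_neg_one {σ : Equiv.Perm (Fin n)} (h : Equiv.Perm.sign σ = -1)
    (z : stdSubspace n) : stdRepSign n σ z = -stdRep n σ z := by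
  rw [stdRepSign_apply, h, Units.val_neg, Units.val_one, Int.cast_neg, Int.cast_one]
  exact neg_one_smul ℂ (stdRep n σ z)

lemma finRotate_pow_self (hn : 2 ≤ n) : finRotate n ^ n = 1 := by
  have h := (isCycle_finRotate_of_le hn).orderOf
  rw [support_finRotate_of_le hn, Finset.card_univ, Fintype.card_fin] at h
  exact orderOf_dvd_iff_pow_eq_one.1 h.dvd

/-- The long cycle fixes no nonzero vector of the standard representation. -/
lemma stdRep_finRotate_ne (hn : 2 ≤ n) {z : stdSubspace n} (hz : z ≠ 0) :
    stdRep n (finRotate n) z ≠ z := by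
  intro h
  apply hz
  have hstep : ∀ i, z.1 (finRotate n i) = z.1 i := fun i => by
    have := congrFun (congrArg Subtype.val h) (finRotate n i)
    rw [stdRep_apply, Equiv.Perm.inv_def, Equiv.symm_apply_apply] at this
    exact this.symm
  have hpow : ∀ m : ℕ, ∀ i, z.1 ((finRotate n ^ m) i) = z.1 i := by
    intro m
    induction m with
    | zero => simp
    | succ m ih => intro i; rw [pow_succ', Equiv.Perm.mul_apply, hstep, ih]
  have hconst : ∀ i j, z.1 i = z.1 j := by
    intro i j
    have hmem : ∀ x, finRotate n x ≠ x := fun x => by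
      rw [← Equiv.Perm.mem_support, support_finRotate_of_le hn]
      exact Finset.mem_univ x
    obtain ⟨m, hm⟩ := (isCycle_finRotate_of_le hn).exists_pow_eq (hmem j) (hmem i)
    rw [← hm, hpow]
  have hsum : ∑ i, z.1 i = 0 := z.2
  ext i
  rw [Finset.sum_congr rfl fun j _ => hconst j i, Finset.sum_const, Finset.card_univ,
    Fintype.card_fin, nsmul_eq_mul, mul_eq_zero] at hsum
  have : (n : ℂ) ≠ 0 := by
    exact_mod_cast (by omega : n ≠ 0)
  simpa [this] using hsum

lemma prime_dvd_orbitCard_stdRep {p k : ℕ} (hp : p.Prime) (hn : n = p ^ k) (hn2 : 2 ≤ n)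
    {z : stdSubspace n} (hz : z ≠ 0) : p ∣ orbitCard (stdRep n) z :=
  prime_dvd_orbitCard_of_pow_eq_one _ _ (m := k) hp (finRotate n)
    (hn ▸ finRotate_pow_self hn2) fun h => stdRep_finRotate_ne hn2 (apply_ne_zero _ h hz)

lemma prime_dvd_orbitCard_stdRepSign {p k : ℕ} (hp : p.Prime) (hn : n = p ^ k) (hn2 : 2 ≤ n)
    (hodd : Odd n) {z : stdSubspace n} (hz : z ≠ 0) : p ∣ orbitCard (stdRepSign n) z := by
  refine prime_dvd_orbitCard_of_pow_eq_one _ _ (m := k) hp (finRotate n)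
    (hn ▸ finRotate_pow_self hn2) fun h => ?_
  rw [stdRepSign_of_sign_eq_one]
  · exact stdRep_finRotate_ne hn2 (apply_ne_zero _ h hz)
  · rw [sign_finRotate, Even.neg_one_pow]
    exact hodd.tsub_odd odd_one

/-- If two coordinates of `z` agree, its twisted orbit is closed under negation. -/
lemma neg_mem_range_stdRepSign {z : stdSubspace n} {i j : Fin n} (hij : i ≠ j)
    (hz : z.1 i = z.1 j) (σ : Equiv.Perm (Fin n)) :
    -stdRepSign n σ z ∈ Set.range fun τ => stdRepSign n τ z := by
  refine ⟨σ * Equiv.swap i j, ?_⟩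
  have hfix : stdRep n (Equiv.swap i j) z = z := by
    ext a
    rw [stdRep_apply, Equiv.swap_inv]
    rcases eq_or_ne a i with rfl | hai
    · rw [Equiv.swap_apply_left, hz]
    rcases eq_or_ne a j with rfl | haj
    · rw [Equiv.swap_apply_right, hz]
    · rw [Equiv.swap_apply_of_ne_of_ne hai haj]
  simp only [map_mul, Module.End.mul_apply]
  rw [stdRepSign_of_sign_eq_neg_one (Equiv.Perm.sign_swap hij), hfix, map_neg]

lemma two_dvd_orbitCard_stdRepSign (hn : 4 ≤ n) {z : stdSubspace n} (hz : z ≠ 0) :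
    2 ∣ orbitCard (stdRepSign n) z := by
  by_cases hinj : Function.Injective z.1
  · let a : Fin n := ⟨0, by omega⟩
    let b : Fin n := ⟨1, by omega⟩
    let c : Fin n := ⟨2, by omega⟩
    let d : Fin n := ⟨3, by omega⟩
    have hab : a ≠ b := by simp [a, b]
    have hac : a ≠ c := by simp [a, c]
    have had : a ≠ d := by simp [a, d]
    have hbc : b ≠ c := by simp [b, c]
    have hbd : b ≠ d := by simp [b, d]
    have hcd : c ≠ d := by simp [c, d]
    have hcomm : Commute (Equiv.swap a b) (Equiv.swap c d) :=
      (Equiv.Perm.disjoint_swap_swap (by simp [*])).commute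
    have hsign : Equiv.Perm.sign (Equiv.swap a b * Equiv.swap c d) = 1 := by
      simp [Equiv.Perm.sign_swap hab, Equiv.Perm.sign_swap hcd]
    refine prime_dvd_orbitCard_of_pow_eq_one _ _ (m := 1) Nat.prime_two
      (Equiv.swap a b * Equiv.swap c d) ?_ fun σ h => ?_
    · rw [pow_one, hcomm.mul_pow, sq, sq, Equiv.swap_mul_self, Equiv.swap_mul_self, one_mul]
    · rw [stdRepSign_of_sign_eq_one hsign] at h
      have h' := congrFun (congrArg Subtype.val h) a
      rw [stdRep_apply, stdRepSign_apply] at h'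
      have hs : ((Equiv.Perm.sign σ : ℤ) : ℂ) ≠ 0 := by simp
      have h2 := mul_left_cancel₀ hs h'
      rw [stdRep_apply, stdRep_apply] at h2
      have h3 := σ⁻¹.injective (hinj h2)
      rw [mul_inv_rev, Equiv.swap_inv, Equiv.swap_inv, Equiv.Perm.mul_apply,
        Equiv.swap_apply_left, Equiv.swap_apply_of_ne_of_ne hbc hbd] at h3
      exact hab h3.symm
  · simp only [Function.Injective, not_forall] at hinj
    obtain ⟨i, j, hij, hne⟩ := hinj
    refine prime_dvd_orbitCard _ _ (m := 1) Nat.prime_two (fun w => -w)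
      (neg_mem_range_stdRepSign hne hij) (fun σ => by simp) fun σ h => ?_
    refine apply_ne_zero (stdRepSign n) σ hz (Subtype.ext (funext fun a => ?_))
    exact neg_eq_self.1 (congrFun (congrArg Subtype.val h) a)

/-- The vector of the standard representation taking one value on `S` and another one off `S`. -/
noncomputable def twoValued (S : Finset (Fin n)) : stdSubspace n :=
  ⟨fun i => (if i ∈ S then (n : ℂ) else 0) - S.card, by
    show ∑ i, ((if i ∈ S then (n : ℂ) else 0) - S.card) = 0
    simp [Finset.sum_sub_distrib, Finset.sum_ite_mem, mul_comm]⟩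

lemma twoValued_apply (S : Finset (Fin n)) (i : Fin n) :
    (twoValued S).1 i = (if i ∈ S then (n : ℂ) else 0) - S.card := rfl

lemma stdRep_twoValued (σ : Equiv.Perm (Fin n)) (S : Finset (Fin n)) :
    stdRep n σ (twoValued S) = twoValued (S.map σ.toEmbedding) := by
  ext i
  rw [stdRep_apply, twoValued_apply, twoValued_apply, Finset.card_map]
  have : σ⁻¹ i ∈ S ↔ i ∈ S.map σ.toEmbedding := by
    rw [Finset.mem_map_equiv]; rfl
  simp only [this]

lemma twoValued_injOn (hn : 0 < n) (m : ℕ) :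
    Set.InjOn (twoValued (n := n)) {S | S.card = m} := by
  intro S hS T hT h
  have hn' : (n : ℂ) ≠ 0 := by exact_mod_cast hn.ne'
  ext i
  have := congrFun (congrArg Subtype.val h) i
  rw [twoValued_apply, twoValued_apply, hS, hT, sub_left_inj] at this
  by_cases h1 : i ∈ S <;> by_cases h2 : i ∈ T <;> simp_all [eq_comm]

lemma range_stdRep_twoValued (S : Finset (Fin n)) :
    (Set.range fun σ => stdRep n σ (twoValued S)) = twoValued '' {T | T.card = S.card} := by
  ext w
  constructor
  · rintro ⟨σ, rfl⟩
    exact ⟨S.map σ.toEmbedding, Finset.card_map _, (stdRep_twoValued σ S).symm⟩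
  · rintro ⟨T, hT, rfl⟩
    let e : {x // x ∈ S} ≃ {x // x ∈ T} := Finset.equivOfCardEq (Eq.symm hT)
    refine ⟨e.extendSubtype, ?_⟩
    simp only [stdRep_twoValued]
    congr 1
    refine Finset.eq_of_subset_of_card_le (fun x hx => ?_) (by rw [Finset.card_map]; exact hT.le)
    obtain ⟨y, hy, rfl⟩ := Finset.mem_map.1 hx
    exact e.extendSubtype_mem y hy

lemma orbitCard_stdRep_twoValued (hn : 0 < n) (S : Finset (Fin n)) :
    orbitCard (stdRep n) (twoValued S) = n.choose S.card := by
  rw [orbitCard, range_stdRep_twoValued, Nat.card_image_of_injOn (twoValued_injOn hn _)]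
  have := Fintype.card_finset_len (α := Fin n) S.card
  rw [Fintype.card_fin] at this
  rw [← this, ← Nat.card_eq_fintype_card]
  rfl

lemma twoValued_ne_zero {S : Finset (Fin n)} (h0 : 0 < S.card) (hS : S.card < n) :
    twoValued S ≠ 0 := by
  intro h
  obtain ⟨i, hi⟩ := Finset.card_pos.1 h0
  have := congrFun (congrArg Subtype.val h) i
  rw [twoValued_apply, if_pos hi] at this
  have h2 : (n : ℂ) = S.card := sub_eq_zero.1 this
  exact hS.ne' (by exact_mod_cast h2)

lemma neg_twoValued_ne (hodd : Odd n) {S T : Finset (Fin n)} (h0 : 0 < S.card)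
    (hS : S.card < n) (hT : T.card = S.card) : -twoValued S ≠ twoValued T := by
  intro h
  obtain ⟨i, hi⟩ := Finset.card_pos.1 h0
  have := congrFun (congrArg Subtype.val h) i
  change -(twoValued S).1 i = _ at this
  rw [twoValued_apply, twoValued_apply, if_pos hi, hT] at this
  split_ifs at this
  · have h2 : (n : ℂ) = S.card := by linear_combination -this / 2
    exact hS.ne' (by exact_mod_cast h2)
  · have h2 : (n : ℂ) = 2 * S.card := by linear_combination -this
    have h3 : n = 2 * S.card := by exact_mod_cast h2
    exact (Nat.not_even_iff_odd.2 hodd) (h3 ▸ even_two_mul _)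

lemma range_stdRepSign_eq_union {z : stdSubspace n} {i j : Fin n} (hij : i ≠ j)
    (hz : z.1 i = z.1 j) :
    (Set.range fun σ => stdRepSign n σ z) =
      (Set.range fun σ => stdRep n σ z) ∪ Neg.neg '' (Set.range fun σ => stdRep n σ z) := by
  have key : ∀ σ, (stdRepSign n σ z = stdRep n σ z) ∨ (stdRepSign n σ z = -stdRep n σ z) :=
    fun σ => (Int.units_eq_one_or (Equiv.Perm.sign σ)).imp
      (fun h => stdRepSign_of_sign_eq_one h z) (fun h => stdRepSign_of_sign_eq_neg_one h z)
  refine Set.Subset.antisymm ?_ (Set.union_subset ?_ ?_)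
  · rintro _ ⟨σ, rfl⟩
    rcases key σ with h | h
    · exact Or.inl ⟨σ, h.symm⟩
    · exact Or.inr ⟨_, ⟨σ, rfl⟩, h.symm⟩
  · rintro _ ⟨σ, rfl⟩
    rcases key σ with h | h
    · exact ⟨σ, h⟩
    · have := neg_mem_range_stdRepSign hij hz σ
      rwa [h, neg_neg] at this
  · rintro _ ⟨_, ⟨σ, rfl⟩, rfl⟩
    rcases key σ with h | h
    · have := neg_mem_range_stdRepSign hij hz σ
      rwa [h] at this
    · exact ⟨σ, h⟩

lemma orbitCard_stdRepSign_twoValued (hodd : Odd n) (hn : 3 ≤ n) {S : Finset (Fin n)}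
    (h0 : 0 < S.card) (hS : S.card < n) :
    orbitCard (stdRepSign n) (twoValued S) = 2 * n.choose S.card := by
  obtain ⟨i, j, hij, hz⟩ : ∃ i j, i ≠ j ∧ (twoValued S).1 i = (twoValued S).1 j := by
    obtain ⟨i, j, hij, h⟩ := Fintype.exists_ne_map_eq_of_card_lt
      (fun i : Fin n => decide (i ∈ S)) (by simp; omega)
    refine ⟨i, j, hij, ?_⟩
    simp only [decide_eq_decide] at h
    simp only [twoValued_apply, h]
  rw [← orbitCard_stdRep_twoValued (by omega) S, orbitCard, orbitCard,
    range_stdRepSign_eq_union hij hz, Nat.card_coe_set_eq, Nat.card_coe_set_eq,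
    Set.ncard_union_eq ?_ (Set.finite_range _) ((Set.finite_range _).image _),
    Set.ncard_image_of_injective _ neg_injective, two_mul]
  rw [range_stdRep_twoValued, Set.disjoint_left]
  rintro _ ⟨T, hT, rfl⟩ ⟨_, ⟨U, hU, rfl⟩, h⟩
  have hT' : T.card = S.card := hT
  have hU' : U.card = S.card := hU
  exact neg_twoValued_ne hodd (hU' ▸ h0) (hU' ▸ hS) (hT'.trans hU'.symm) h

lemma gcd_choose_prime_pow {p k : ℕ} (hp : p.Prime) (hk : 1 ≤ k) :
    Nat.gcd ((p ^ k).choose 1) ((p ^ k).choose (p ^ (k - 1))) ∣ p := by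
  rw [Nat.choose_one_right]
  obtain ⟨i, -, hi⟩ := (Nat.dvd_prime_pow hp).1 (Nat.gcd_dvd_left (p ^ k) _)
  have hle : p ^ (k - 1) ≤ p ^ k := Nat.pow_le_pow_right hp.pos (Nat.sub_le _ _)
  have hdvd := Nat.gcd_dvd_right (p ^ k) ((p ^ k).choose (p ^ (k - 1)))
  rw [hi] at hdvd ⊢
  rw [hp.pow_dvd_iff_le_factorization (Nat.choose_pos hle).ne',
    Nat.factorization_choose_prime_pow hp hle (pow_pos hp.pos _).ne',
    hp.factorization_pow, Finsupp.single_eq_same] at hdvd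
  exact (pow_dvd_pow p (by omega : i ≤ 1)).trans (pow_one p).dvd

end AlphaChar

open AlphaChar in
/-- for an odd prime power n = p^k > 3, the standard representation V of
Sₙ has α(V) = p and its sign-twist V⁻ has α(V⁻) = 2p. -/
theorem alphaChar_std_and_signTwist (p k n : ℕ) (hp : p.Prime) (hk : 1 ≤ k)
    (hn : n = p ^ k) (hn3 : 3 < n) (hodd : Odd n) :
    alphaChar (stdRep n) = p ∧ alphaChar (stdRepSign n) = 2 * p := by
  have hp_odd : Odd p := (Nat.odd_pow_iff (by omega)).1 (hn ▸ hodd)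
  have hlt : p ^ (k - 1) < n := hn ▸ Nat.pow_lt_pow_right hp.one_lt (by omega)
  have hex : ∀ m ≤ n, ∃ S : Finset (Fin n), S.card = m := fun m hm => by
    obtain ⟨S, -, hS⟩ := Finset.exists_subset_card_eq (s := (Finset.univ : Finset (Fin n)))
      (n := m) (by simpa using hm)
    exact ⟨S, hS⟩
  obtain ⟨S, hS⟩ := hex 1 (by omega)
  obtain ⟨T, hT⟩ := hex _ hlt.le
  have hT0 : 0 < T.card := hT ▸ pow_pos hp.pos _
  have hgcd := gcd_choose_prime_pow hp hk
  rw [← hn, ← hT, ← hS] at hgcd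
  have hS_ne := twoValued_ne_zero (S := S) (by omega) (by omega)
  have hT_ne := twoValued_ne_zero hT0 (by omega)
  constructor
  · refine Nat.dvd_antisymm ((Nat.dvd_gcd ?_ ?_).trans hgcd)
      (dvd_alphaChar _ fun v hv => prime_dvd_orbitCard_stdRep hp hn (by omega) hv)
    · rw [← orbitCard_stdRep_twoValued (by omega)]
      exact alphaChar_dvd_orbitCard _ hS_ne
    · rw [← orbitCard_stdRep_twoValued (by omega)]
      exact alphaChar_dvd_orbitCard _ hT_ne
  · refine Nat.dvd_antisymm ((Nat.dvd_gcd ?_ ?_).trans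
      ((Nat.gcd_mul_left 2 _ _).dvd.trans (mul_dvd_mul_left 2 hgcd)))
      (dvd_alphaChar _ fun v hv => Nat.Coprime.mul_dvd_of_dvd_of_dvd
        (Nat.coprime_two_left.2 hp_odd) (two_dvd_orbitCard_stdRepSign hn3 hv)
        (prime_dvd_orbitCard_stdRepSign hp hn (by omega) hodd hv))
    · rw [← orbitCard_stdRepSign_twoValued hodd hn3.le (by omega) (by omega)]
      exact alphaChar_dvd_orbitCard _ hS_ne
    · rw [← orbitCard_stdRepSign_twoValued hodd hn3.le hT0 (by omega)]
      exact alphaChar_dvd_orbitCard _ hT_ne
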